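/- Let A : dom A ⊆ H₁ → H₁, B : dom B ⊆ H₂ → H₁, C : dom C ⊆ H₁ → H₂, D : dom D ⊆ H₂ → H₂ be linear operators and let 𝒜 be the operator matrix on H = H₁ ⊕ H₂ with dom 𝒜 := (dom A ∩ dom C) ⊕ (dom B ∩ dom D) and 𝒜(f, g) := (Af + Bg, Cf + Dg). Assume: (a) ⟨Bg, f⟩ = ⟨g, Cf⟩ for all g ∈ dom B, f ∈ dom C (i.e. C ⊆ B*); (b) there exist δ < 0 < α, φ ∈ [0, π/2] and ψ ∈ [0, π/2) such that Re⟨Af, f⟩ ≥ α‖f‖² and ⟨Af, f⟩ ∈ Σ_φ for all f ∈ dom A, and Re⟨Dg, g⟩ ≤ δ‖g‖² and ⟨Dg, g⟩ ∈ −Σ_ψ for all g ∈ dom D; (c) dom D ⊆ dom B and B is D-bounded; (d) with τ := max{φ, ψ}, for every μ ∈ ℂ with Re μ ∈ (δ, α) or |arg μ| ∈ (τ, π − τ), the operator D − μ maps dom D bijectively onto H₂ (this holds when −D is m-sectorial with vertex 0). Then σ_ap(𝒜) ⊆ Σ := (−Σ_τ ∪ Σ_τ) ∩ {z ∈ ℂ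 : Re z ∉ (δ, α)}. -/

import Mathlib

open Filter Topology Real

noncomputable section

variable {H₁ H₂ : Type*}
  [NormedAddCommGroup H₁] [InnerProductSpace ℂ H₁] [CompleteSpace H₁]
  [NormedAddCommGroup H₂] [InnerProductSpace ℂ H₂] [CompleteSpace H₂]

local notation "⟪" x ", " y "⟫" => @inner ℂ _ _ x y

/-- The closed sector `Σ_ω = {z ∈ ℂ : |arg z| ≤ ω}`. -/
def SigmaSector (ω : ℝ) : Set ℂ := {z : ℂ | |z.arg| ≤ ω}

/-- Points of `Σ_ω` satisfy the linear inequalities describing `Σ_τ` for `ω ≤ τ ≤ π / 2`. -/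
lemma SigmaSector.re_nonneg_and_abs_im_mul_cos_le {ω τ : ℝ} (hωτ : ω ≤ τ) (hτ : τ ≤ π / 2)
    {z : ℂ} (hz : z ∈ SigmaSector ω) :
    0 ≤ z.re ∧ |z.im| * cos τ ≤ z.re * sin τ := by
  have hz : |z.arg| ≤ τ := le_trans hz hωτ
  have h0 := abs_nonneg z.arg
  have hre : z.re = ‖z‖ * cos |z.arg| := by
    rw [Real.cos_abs, Complex.norm_mul_cos_arg]
  have him : |z.im| = ‖z‖ * sin |z.arg| := by
    rw [← Complex.norm_mul_sin_arg z, abs_mul, abs_norm,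
      Real.abs_sin_eq_sin_abs_of_abs_le_pi (Complex.abs_arg_le_pi z)]
  refine ⟨Complex.abs_arg_le_pi_div_two_iff.mp (hz.trans hτ), ?_⟩
  have hs : 0 ≤ sin (τ - |z.arg|) :=
    Real.sin_nonneg_of_nonneg_of_le_pi (by linarith) (by linarith [Real.pi_pos])
  rw [Real.sin_sub] at hs
  rw [hre, him]
  nlinarith [mul_nonneg (norm_nonneg z) hs]

lemma mem_SigmaSector_of_abs_im_mul_cos_le {τ : ℝ} (hτ0 : 0 ≤ τ) {z : ℂ}
    (hre0 : 0 ≤ z.re) (hz : |z.im| * cos τ ≤ z.re * sin τ) : z ∈ SigmaSector τ := by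
  change |z.arg| ≤ τ
  rcases eq_or_ne z 0 with rfl | hne
  · simpa using hτ0
  have hpos : 0 < ‖z‖ := norm_pos_iff.mpr hne
  have harg := Complex.abs_arg_le_pi_div_two_iff.mpr hre0
  have hre : z.re = ‖z‖ * cos |z.arg| := by
    rw [Real.cos_abs, Complex.norm_mul_cos_arg]
  have him : |z.im| = ‖z‖ * sin |z.arg| := by
    rw [← Complex.norm_mul_sin_arg z, abs_mul, abs_norm,
      Real.abs_sin_eq_sin_abs_of_abs_le_pi (Complex.abs_arg_le_pi z)]
  by_contra! hlt
  have hs : 0 < sin (|z.arg| - τ) :=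
    Real.sin_pos_of_pos_of_lt_pi (by linarith) (by linarith [Real.pi_pos])
  rw [Real.sin_sub] at hs
  rw [hre, him] at hz
  nlinarith [mul_pos hpos hs]

lemma mem_neg_SigmaSector_union {τ : ℝ} (hτ0 : 0 ≤ τ) {z : ℂ}
    (hz : |z.im| * cos τ ≤ |z.re| * sin τ) : z ∈ -SigmaSector τ ∪ SigmaSector τ := by
  rcases le_total 0 z.re with h | h
  · exact Or.inr (mem_SigmaSector_of_abs_im_mul_cos_le hτ0 h (by rwa [abs_of_nonneg h] at hz))
  · refine Or.inl (Set.mem_neg.mpr (mem_SigmaSector_of_abs_im_mul_cos_le hτ0 ?_ ?_))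
    · simpa using h
    · simpa [abs_of_nonpos h] using hz

/-- Inner products of a bounded sequence with a null sequence tend to `0`. -/
lemma tendsto_inner_zero_of_norm_le_one {E : Type*} [NormedAddCommGroup E]
    [InnerProductSpace ℂ E] {u v : ℕ → E} (hu : ∀ n, ‖u n‖ ≤ 1) (hv : Tendsto v atTop (𝓝 0)) :
    Tendsto (fun n => ⟪u n, v n⟫) atTop (𝓝 0) := by
  refine squeeze_zero_norm (fun n => ?_) (tendsto_zero_iff_norm_tendsto_zero.mp hv)
  exact (norm_inner_le_norm _ _).trans (mul_le_of_le_one_left (norm_nonneg _) (hu n))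

/-- Spectral enclosure for the operator matrix `𝒜 = [[A, B], [C, D]]` with `C ⊆ B*`:
if `Re W(A) ≥ α > 0 > δ ≥ Re W(D)`, `W(A) ⊆ Σ_φ`, `W(D) ⊆ −Σ_ψ` with `ψ < π/2`, `B` is
`D`-bounded, and `D − μ` is bijective from `dom D` onto `H₂` for all `μ` with
`Re μ ∈ (δ, α)` or `|arg μ| ∈ (τ, π − τ)` (with `τ = max{φ, ψ}`), then
`σ_ap(𝒜) ⊆ Σ = (−Σ_τ ∪ Σ_τ) ∩ {Re z ∉ (δ, α)}`. -/
theorem sigmaAp_subset_sector_strip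
    (A : H₁ →ₗ.[ℂ] H₁) (B : H₂ →ₗ.[ℂ] H₁) (C : H₁ →ₗ.[ℂ] H₂) (D : H₂ →ₗ.[ℂ] H₂)
    (hCB : ∀ (g : B.domain) (f : C.domain), ⟪(f : H₁), B g⟫ = ⟪C f, (g : H₂)⟫)
    (δ α : ℝ) (hδ : δ < 0) (hα : 0 < α)
    (φ ψ : ℝ) (hφ0 : 0 ≤ φ) (hφ1 : φ ≤ π / 2) (hψ0 : 0 ≤ ψ) (hψ1 : ψ < π / 2)
    (hAre : ∀ f : A.domain, α * ‖(f : H₁)‖ ^ 2 ≤ (⟪(f : H₁), A f⟫).re)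
    (hAsec : ∀ f : A.domain, ⟪(f : H₁), A f⟫ ∈ SigmaSector φ)
    (hDre : ∀ g : D.domain, (⟪(g : H₂), D g⟫).re ≤ δ * ‖(g : H₂)‖ ^ 2)
    (hDsec : ∀ g : D.domain, ⟪(g : H₂), D g⟫ ∈ -SigmaSector ψ)
    (hDB : (D.domain : Set H₂) ⊆ (B.domain : Set H₂))
    (hBbd : ∃ a b : ℝ, 0 ≤ a ∧ 0 ≤ b ∧ ∀ (g : H₂) (hg : g ∈ D.domain),
      ‖B ⟨g, hDB hg⟩‖ ≤ a * ‖g‖ + b * ‖D ⟨g, hg⟩‖)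
    (hbij : ∀ μ : ℂ, ((δ < μ.re ∧ μ.re < α) ∨
        (max φ ψ < |μ.arg| ∧ |μ.arg| < π - max φ ψ)) →
      ∀ h : H₂, ∃! v : D.domain, D v - μ • (v : H₂) = h) :
    ∀ l : ℂ,
      (∃ (f : ℕ → H₁) (g : ℕ → H₂) (hfA : ∀ n, f n ∈ A.domain)
        (hfC : ∀ n, f n ∈ C.domain) (hgB : ∀ n, g n ∈ B.domain)
        (hgD : ∀ n, g n ∈ D.domain),
        (∀ n, ‖(WithLp.equiv 2 (H₁ × H₂)).symm (f n, g n)‖ = 1) ∧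
        Tendsto (fun n => (WithLp.equiv 2 (H₁ × H₂)).symm
          (A ⟨f n, hfA n⟩ + B ⟨g n, hgB n⟩, C ⟨f n, hfC n⟩ + D ⟨g n, hgD n⟩)
          - l • (WithLp.equiv 2 (H₁ × H₂)).symm (f n, g n)) atTop (𝓝 0)) →
      l ∈ ((-SigmaSector (max φ ψ)) ∪ SigmaSector (max φ ψ)) ∩
        {z : ℂ | ¬(δ < z.re ∧ z.re < α)} := by
  rintro l ⟨f, g, hfA, hfC, hgB, hgD, hnorm, hlim⟩
  have hτ0 : 0 ≤ max φ ψ := hφ0.trans (le_max_left _ _)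
  have hτ1 : max φ ψ ≤ π / 2 := max_le hφ1 hψ1.le
  have hFG : ∀ n, ‖f n‖ ^ 2 + ‖g n‖ ^ 2 = 1 := fun n => by
    have h := WithLp.prod_norm_sq_eq_of_L2 ((WithLp.equiv 2 (H₁ × H₂)).symm (f n, g n))
    rw [hnorm n] at h
    simpa using h.symm
  have hf1 : ∀ n, ‖f n‖ ≤ 1 := fun n => by
    nlinarith [hFG n, norm_nonneg (f n), sq_nonneg ‖g n‖]
  have hg1 : ∀ n, ‖g n‖ ≤ 1 := fun n => by
    nlinarith [hFG n, norm_nonneg (g n), sq_nonneg ‖f n‖]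
  have hcont := (WithLp.prod_continuous_ofLp 2 H₁ H₂).tendsto (0 : WithLp 2 (H₁ × H₂))
  have hlim₁ : Tendsto (fun n => A ⟨f n, hfA n⟩ + B ⟨g n, hgB n⟩ - l • f n) atTop (𝓝 0) :=
    (continuous_fst.tendsto _).comp (hcont.comp hlim)
  have hlim₂ : Tendsto (fun n => C ⟨f n, hfC n⟩ + D ⟨g n, hgD n⟩ - l • g n) atTop (𝓝 0) :=
    (continuous_snd.tendsto _).comp (hcont.comp hlim)
  have he₁ := tendsto_inner_zero_of_norm_le_one hf1 hlim₁
  have he₂ := tendsto_inner_zero_of_norm_le_one hg1 hlim₂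
  obtain ⟨e, he⟩ : ∃ e : ℕ → ℂ, e = fun n =>
      ⟪f n, A ⟨f n, hfA n⟩ + B ⟨g n, hgB n⟩ - l • f n⟫ -
        (starRingEnd ℂ) ⟪g n, C ⟨f n, hfC n⟩ + D ⟨g n, hgD n⟩ - l • g n⟫ := ⟨_, rfl⟩
  have hlime : Tendsto e atTop (𝓝 0) := by
    rw [he]
    simpa using he₁.sub ((Complex.continuous_conj.tendsto 0).comp he₂)
  have hlimre : Tendsto (fun n => (e n).re) atTop (𝓝 0) :=
    (Complex.continuous_re.tendsto 0).comp hlime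
  have hlimim : Tendsto (fun n => (e n).im) atTop (𝓝 0) :=
    (Complex.continuous_im.tendsto 0).comp hlime
  have hexp : ∀ n, e n = ⟪f n, A ⟨f n, hfA n⟩⟫ - (starRingEnd ℂ) ⟪g n, D ⟨g n, hgD n⟩⟫
      - l * ((‖f n‖ ^ 2 : ℝ) : ℂ) + (starRingEnd ℂ) l * ((‖g n‖ ^ 2 : ℝ) : ℂ) := fun n => by
    have hBC := hCB ⟨g n, hgB n⟩ ⟨f n, hfC n⟩
    rw [he]
    simp only [inner_add_right, inner_sub_right, inner_smul_right, map_add, map_sub, map_mul,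
      inner_conj_symm, inner_self_eq_norm_sq_to_K] at hBC ⊢
    rw [hBC]
    simp
    ring
  have hre : ∀ n, (e n).re = (⟪f n, A ⟨f n, hfA n⟩⟫).re - (⟪g n, D ⟨g n, hgD n⟩⟫).re
      - l.re * (‖f n‖ ^ 2 - ‖g n‖ ^ 2) := fun n => by
    rw [hexp n]
    simp only [Complex.add_re, Complex.sub_re, Complex.mul_re, Complex.conj_re, Complex.ofReal_re,
      Complex.ofReal_im]
    ring
  have him : ∀ n, (e n).im = (⟪f n, A ⟨f n, hfA n⟩⟫).im + (⟪g n, D ⟨g n, hgD n⟩⟫).im - l.im :=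
    fun n => by
      rw [hexp n]
      simp only [Complex.add_im, Complex.sub_im, Complex.mul_im, Complex.conj_re, Complex.conj_im,
        Complex.ofReal_re, Complex.ofReal_im]
      linear_combination -l.im * hFG n
  refine ⟨mem_neg_SigmaSector_union hτ0 ?_, ?_⟩
  · have hle : ∀ n, |(e n).im + l.im| * cos (max φ ψ) ≤ ((e n).re + |l.re|) * sin (max φ ψ) :=
        fun n => by
      have hA := (SigmaSector.re_nonneg_and_abs_im_mul_cos_le (le_max_left φ ψ) hτ1
        (hAsec ⟨f n, hfA n⟩)).2
      have hD := (SigmaSector.re_nonneg_and_abs_im_mul_cos_le (le_max_right φ ψ) hτ1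
        (Set.mem_neg.mp (hDsec ⟨g n, hgD n⟩))).2
      simp only [Complex.neg_re, Complex.neg_im, abs_neg] at hA hD
      have hsin : 0 ≤ sin (max φ ψ) :=
        Real.sin_nonneg_of_nonneg_of_le_pi hτ0 (by linarith [Real.pi_pos])
      have hcos : 0 ≤ cos (max φ ψ) :=
        Real.cos_nonneg_of_neg_pi_div_two_le_of_le (by linarith [Real.pi_pos]) hτ1
      have hl : l.re * (‖f n‖ ^ 2 - ‖g n‖ ^ 2) ≤ |l.re| := by
        refine (le_abs_self _).trans ?_
        rw [abs_mul]
        refine mul_le_of_le_one_right (abs_nonneg _) (abs_le.mpr ⟨?_, ?_⟩) <;>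
          nlinarith [hFG n, sq_nonneg ‖f n‖, sq_nonneg ‖g n‖]
      rw [him n, hre n, sub_add_cancel]
      refine (mul_le_mul_of_nonneg_right (abs_add_le _ _) hcos).trans ?_
      have := mul_le_mul_of_nonneg_right hl hsin
      linarith
    have hL := (hlimim.add_const l.im).abs.mul_const (cos (max φ ψ))
    have hR := (hlimre.add_const |l.re|).mul_const (sin (max φ ψ))
    simpa using le_of_tendsto_of_tendsto' hL hR hle
  · rintro ⟨h₁, h₂⟩
    have hc : 0 < min (α - l.re) (l.re - δ) := lt_min (by linarith) (by linarith)
    refine hc.not_ge (ge_of_tendsto' hlimre fun n => ?_)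
    have hA := hAre ⟨f n, hfA n⟩
    have hD := hDre ⟨g n, hgD n⟩
    have hF := mul_le_mul_of_nonneg_right (min_le_left (α - l.re) (l.re - δ)) (sq_nonneg ‖f n‖)
    have hG := mul_le_mul_of_nonneg_right (min_le_right (α - l.re) (l.re - δ)) (sq_nonneg ‖g n‖)
    have hsum : min (α - l.re) (l.re - δ) * ‖f n‖ ^ 2 + min (α - l.re) (l.re - δ) * ‖g n‖ ^ 2
        = min (α - l.re) (l.re - δ) := by
      rw [← mul_add, hFG n, mul_one]
    rw [hre n]
    dsimp only at hA hD
    linarith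

end
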